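/- (Fixed-point lower bound for the Augustin mean, α > 1.) Let α ∈ (1,∞) and suppose the positive definite d×d density matrix u satisfies the fixed-point equation u = Σ_i P(i)·(u^{(1−α)/2} W_i^α u^{(1−α)/2}) / Tr[u^{(1−α)/2} W_i^α u^{(1−α)/2}]. Then for every positive definite d×d density matrix τ: Σ_i P(i)·D_α(W_i‖τ) − Σ_i P(i)·D_α(W_i‖u) ≥ D_1(u‖τ), where D_1 denotes the Umegaki relative entropy. -/

import Mathlib

open Matrix
open scoped ComplexOrder

/-- Real power of a (hermitian) matrix via the continuous functional calculus. -/
noncomputable def mpow {ι : Type*} [Fintype ι] [DecidableEq ι]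
    (A : Matrix ι ι ℂ) (r : ℝ) : Matrix ι ι ℂ :=
  cfc (fun x : ℝ => x ^ r) A

/-- Logarithm of a (hermitian) matrix via the continuous functional calculus. -/
noncomputable def mlog {ι : Type*} [Fintype ι] [DecidableEq ι]
    (A : Matrix ι ι ℂ) : Matrix ι ι ℂ :=
  cfc Real.log A

/-- Real part of the trace. -/
noncomputable def trR {ι : Type*} [Fintype ι] (A : Matrix ι ι ℂ) : ℝ :=
  (Matrix.trace A).re

/-- Positive definite density matrices. -/
def Dens (d : ℕ) : Type :=
  {σ : Matrix (Fin d) (Fin d) ℂ // σ.PosDef ∧ σ.trace = 1}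

/-- Petz Rényi divergence of order `α ≠ 1`. -/
noncomputable def Dpetz {d : ℕ} (α : ℝ) (ρ σ : Matrix (Fin d) (Fin d) ℂ) : ℝ :=
  (1 / (α - 1)) * Real.log (trR (mpow ρ α * mpow σ (1 - α)))

/-- Umegaki relative entropy. -/
noncomputable def Dumegaki {d : ℕ} (ρ σ : Matrix (Fin d) (Fin d) ℂ) : ℝ :=
  trR (ρ * (mlog ρ - mlog σ))

/-! ### Linearity of the real trace -/

section RealTrace

variable {ι : Type*} [Fintype ι]

lemma trR_add (A B : Matrix ι ι ℂ) : trR (A + B) = trR A + trR B := by simp [trR]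

lemma trR_sub (A B : Matrix ι ι ℂ) : trR (A - B) = trR A - trR B := by simp [trR]

lemma trR_smul (c : ℝ) (A : Matrix ι ι ℂ) : trR (c • A) = c * trR A := by simp [trR]

lemma trR_mul_comm (A B : Matrix ι ι ℂ) : trR (A * B) = trR (B * A) := by
  rw [trR, trR, trace_mul_comm]

lemma trR_sum {κ : Type*} (s : Finset κ) (A : κ → Matrix ι ι ℂ) :
    trR (∑ i ∈ s, A i) = ∑ i ∈ s, trR (A i) := by
  simp [trR, trace_sum]

lemma continuous_trR : Continuous (trR : Matrix ι ι ℂ → ℝ) :=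
  Complex.continuous_re.comp continuous_id.matrix_trace

end RealTrace

/-! ### Unitarily conjugated real diagonal matrices -/

section ConjDiag

variable {ι : Type*} [Fintype ι] [DecidableEq ι]

/-- The matrix `V * diag(g) * Vᴴ` with real diagonal `g`. -/
noncomputable def conjDiag (V : Matrix ι ι ℂ) (g : ι → ℝ) : Matrix ι ι ℂ :=
  V * diagonal (fun i => (g i : ℂ)) * Vᴴ

lemma conjDiag_mul {V : Matrix ι ι ℂ} (hV : Vᴴ * V = 1) (g h : ι → ℝ) :
    conjDiag V g * conjDiag V h = conjDiag V (fun i => g i * h i) := by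
  have : conjDiag V g * conjDiag V h
      = V * (diagonal (fun i => (g i : ℂ)) * (Vᴴ * V) * diagonal (fun i => (h i : ℂ))) * Vᴴ := by
    simp only [conjDiag, mul_assoc]
  rw [this, hV, mul_one, diagonal_mul_diagonal]
  simp [conjDiag]

lemma conjDiag_one {V : Matrix ι ι ℂ} (hV : V * Vᴴ = 1) : conjDiag V (fun _ => 1) = 1 := by
  simp [conjDiag, hV]

lemma conjDiag_add (V : Matrix ι ι ℂ) (g h : ι → ℝ) :
    conjDiag V g + conjDiag V h = conjDiag V (fun i => g i + h i) := by
  simp only [conjDiag, ← add_mul, ← mul_add, diagonal_add]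
  simp

lemma conjDiag_sub (V : Matrix ι ι ℂ) (g h : ι → ℝ) :
    conjDiag V g - conjDiag V h = conjDiag V (fun i => g i - h i) := by
  simp only [conjDiag, ← sub_mul, ← mul_sub, diagonal_sub]
  simp

lemma conjDiag_smul (V : Matrix ι ι ℂ) (c : ℝ) (g : ι → ℝ) :
    c • conjDiag V g = conjDiag V (fun i => c * g i) := by
  have : diagonal (fun i => ((c * g i : ℝ) : ℂ)) = c • diagonal (fun i => (g i : ℂ)) := by
    ext i j
    by_cases h : i = j <;> simp [h, Matrix.diagonal]
  simp only [conjDiag, this, mul_smul_comm, smul_mul_assoc]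

lemma trR_mul_conjDiag (K V : Matrix ι ι ℂ) (g : ι → ℝ) :
    trR (K * conjDiag V g) = ∑ j, g j * ((Vᴴ * K * V) j j).re := by
  have : trace (K * conjDiag V g) = trace (Vᴴ * K * V * diagonal (fun i => (g i : ℂ))) := by
    rw [conjDiag, trace_mul_comm (Vᴴ * K * V), ← mul_assoc, ← mul_assoc, trace_mul_comm _ Vᴴ]
    rw [← mul_assoc, ← mul_assoc, trace_mul_comm]
  rw [trR, this, trace, Complex.re_sum]
  refine Finset.sum_congr rfl fun j _ => ?_
  simp [mul_comm]

/-- The spectral decomposition of a positive definite matrix together with its functional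
calculus. -/
lemma Matrix.PosDef.exists_conjDiag {Y : Matrix ι ι ℂ} (hY : Y.PosDef) :
    ∃ (V : Matrix ι ι ℂ) (y : ι → ℝ), Vᴴ * V = 1 ∧ V * Vᴴ = 1 ∧ (∀ i, 0 < y i) ∧
      Y = conjDiag V y ∧ ∀ f : ℝ → ℝ, cfc f Y = conjDiag V (fun i => f (y i)) := by
  have key : ∀ f : ℝ → ℝ, cfc f Y =
      conjDiag (hY.1.eigenvectorUnitary : Matrix ι ι ℂ) (fun i => f (hY.1.eigenvalues i)) := by
    intro f
    rw [hY.1.cfc_eq]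
    rfl
  refine ⟨hY.1.eigenvectorUnitary, hY.1.eigenvalues, ?_, ?_, hY.eigenvalues_pos, ?_, key⟩
  · exact Unitary.coe_star_mul_self hY.1.eigenvectorUnitary
  · exact Unitary.coe_mul_star_self hY.1.eigenvectorUnitary
  · have := key id
    rwa [cfc_id ℝ Y hY.1.isSelfAdjoint] at this

lemma conjDiag_posDef {V : Matrix ι ι ℂ} (hV : V * Vᴴ = 1) {g : ι → ℝ}
    (hg : ∀ i, 0 < g i) : (conjDiag V g).PosDef := by
  refine (PosDef.diagonal (d := fun i => (g i : ℂ)) fun i => ?_).mul_mul_conjTranspose_same ?_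
  · exact_mod_cast hg i
  · intro a b hab
    have := congrArg (fun w => w ᵥ* Vᴴ) hab
    simpa [vecMul_vecMul, hV] using this

end ConjDiag

/-! ### Powers and logarithms of positive definite matrices -/

section Powers

variable {ι : Type*} [Fintype ι] [DecidableEq ι]

lemma mpow_posDef {A : Matrix ι ι ℂ} (hA : A.PosDef) (r : ℝ) : (mpow A r).PosDef := by
  obtain ⟨V, y, _, h2, hy, _, hf⟩ := hA.exists_conjDiag
  rw [mpow, hf]
  exact conjDiag_posDef h2 fun i => Real.rpow_pos_of_pos (hy i) r

lemma mpow_mul_mpow {A : Matrix ι ι ℂ} (hA : A.PosDef) (r s : ℝ) :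
    mpow A r * mpow A s = mpow A (r + s) := by
  obtain ⟨V, y, h1, _, hy, _, hf⟩ := hA.exists_conjDiag
  simp only [mpow, hf, conjDiag_mul h1, ← Real.rpow_add (hy _)]

lemma mpow_zero {A : Matrix ι ι ℂ} (hA : A.PosDef) : mpow A 0 = 1 := by
  obtain ⟨V, y, _, h2, _, _, hf⟩ := hA.exists_conjDiag
  simp only [mpow, hf, Real.rpow_zero, conjDiag_one h2]

lemma mlog_mpow {A : Matrix ι ι ℂ} (hA : A.PosDef) (r : ℝ) :
    mlog (mpow A r) = r • mlog A := by
  have hpos : ∀ x ∈ spectrum ℝ A, 0 < x := by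
    intro x hx
    rw [hA.1.spectrum_real_eq_range_eigenvalues] at hx
    obtain ⟨i, rfl⟩ := hx
    exact hA.eigenvalues_pos i
  have hcomp : mlog (mpow A r) = cfc (fun x => Real.log (x ^ r)) A := by
    rw [mlog, mpow, ← cfc_comp' Real.log (fun x : ℝ => x ^ r) A
      ((A.finite_real_spectrum.image _).continuousOn _)
      (A.finite_real_spectrum.continuousOn _) hA.1.isSelfAdjoint]
  rw [hcomp, mlog, cfc_congr (g := fun x => r * Real.log x)
    fun x hx => Real.log_rpow (hpos x hx) r]
  obtain ⟨V, y, _, _, _, _, hf⟩ := hA.exists_conjDiag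
  rw [hf, hf, conjDiag_smul]

lemma trR_mul_pos [Nonempty ι] {A B : Matrix ι ι ℂ} (hA : A.PosDef) (hB : B.PosDef) :
    0 < trR (A * B) := by
  obtain ⟨V, y, h1, _, hy, hB', _⟩ := hB.exists_conjDiag
  rw [hB', trR_mul_conjDiag]
  have hpd : (Vᴴ * A * V).PosDef := by
    refine hA.conjTranspose_mul_mul_same ?_
    intro a b hab
    have := congrArg (fun w => Vᴴ *ᵥ w) hab
    simpa [mulVec_mulVec, h1] using this
  exact Finset.sum_pos (fun j _ => mul_pos (hy j) (Complex.pos_iff.1 (hpd.diag_pos (i := j))).1)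
    Finset.univ_nonempty

/-- Jensen's inequality for the logarithm in a density matrix. -/
lemma trR_mul_mlog_le_log {A X : Matrix ι ι ℂ} (hA : A.PosSemidef) (hA1 : trR A = 1)
    (hX : X.PosDef) : trR (A * mlog X) ≤ Real.log (trR (A * X)) := by
  obtain ⟨V, y, _, h2, hy, hX', hf⟩ := hX.exists_conjDiag
  have hlog : mlog X = conjDiag V (fun i => Real.log (y i)) := hf _
  have hpsd : (Vᴴ * A * V).PosSemidef := hA.conjTranspose_mul_mul_same V
  have hw : ∑ j, ((Vᴴ * A * V) j j).re = 1 := by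
    have := trR_mul_conjDiag A V (fun _ => 1)
    rw [conjDiag_one h2, mul_one, hA1] at this
    simpa using this.symm
  rw [hlog, hX', trR_mul_conjDiag, trR_mul_conjDiag]
  have := strictConcaveOn_log_Ioi.concaveOn.le_map_sum (t := Finset.univ)
    (w := fun j => ((Vᴴ * A * V) j j).re) (p := y)
    (fun j _ => (Complex.nonneg_iff.1 (hpsd.diag_nonneg (i := j))).1) hw (fun j _ => hy j)
  simpa [mul_comm] using this

end Powers

/-! ### An integral representation of the logarithm -/

section LogIntegral

variable {ι : Type*} [Fintype ι] [DecidableEq ι]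

lemma one_add_mul_sub_one_pos {x y : ℝ} (hx : x ∈ Set.Icc (0 : ℝ) 1) (hy : 0 < y) :
    0 < 1 + x * (y - 1) := by
  rcases hx with ⟨h0, h1⟩
  rcases eq_or_lt_of_le h0 with rfl | h
  · simp
  · nlinarith [mul_pos h hy]

lemma integral_sub_one_div {y : ℝ} (hy : 0 < y) :
    ∫ x in (0 : ℝ)..1, (y - 1) * (1 + x * (y - 1))⁻¹ = Real.log y := by
  have hne : ∀ x ∈ Set.uIcc (0 : ℝ) 1, 1 + x * (y - 1) ≠ 0 := fun x hx =>
    (one_add_mul_sub_one_pos (Set.uIcc_of_le zero_le_one (α := ℝ) ▸ hx) hy).ne'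
  rw [intervalIntegral.integral_eq_sub_of_hasDerivAt (f := fun x => Real.log (1 + x * (y - 1)))]
  · simp
  · intro x hx
    have h : HasDerivAt (fun x : ℝ => 1 + x * (y - 1)) (y - 1) x := by
      simpa using ((hasDerivAt_id x).mul_const (y - 1)).const_add 1
    simpa [div_eq_mul_inv] using h.log (hne x hx)
  · refine ContinuousOn.intervalIntegrable ?_
    exact continuousOn_const.mul (ContinuousOn.inv₀ (by fun_prop) hne)

lemma integral_div_sq {y : ℝ} (hy : 0 < y) :
    ∫ x in (0 : ℝ)..1, y * ((1 + x * (y - 1))⁻¹ * (1 + x * (y - 1))⁻¹) = 1 := by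
  have hne : ∀ x ∈ Set.uIcc (0 : ℝ) 1, 1 + x * (y - 1) ≠ 0 := fun x hx =>
    (one_add_mul_sub_one_pos (Set.uIcc_of_le zero_le_one (α := ℝ) ▸ hx) hy).ne'
  rw [intervalIntegral.integral_eq_sub_of_hasDerivAt (f := fun x => y * (x / (1 + x * (y - 1))))]
  · simp [hy.ne']
  · intro x hx
    have h : HasDerivAt (fun x : ℝ => 1 + x * (y - 1)) (y - 1) x := by
      simpa using ((hasDerivAt_id x).mul_const (y - 1)).const_add 1
    refine (((hasDerivAt_id' x).div h (hne x hx)).const_mul y).congr_deriv ?_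
    have := hne x hx
    field_simp
    ring
  · refine ContinuousOn.intervalIntegrable ?_
    exact continuousOn_const.mul ((ContinuousOn.inv₀ (by fun_prop) hne).mul
      (ContinuousOn.inv₀ (by fun_prop) hne))

/-- The inverse of the segment point `(1 - x) • 1 + x • Y`. -/
noncomputable def segInv (x : ℝ) (Y : Matrix ι ι ℂ) : Matrix ι ι ℂ :=
  (1 + x • (Y - 1))⁻¹

lemma segment_conjDiag {V : Matrix ι ι ℂ} (h2 : V * Vᴴ = 1) (x : ℝ) (y : ι → ℝ) :
    1 + x • (conjDiag V y - 1) = conjDiag V (fun i => 1 + x * (y i - 1)) := by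
  rw [← conjDiag_one h2, conjDiag_sub, conjDiag_smul, conjDiag_add]

lemma segInv_conjDiag {V : Matrix ι ι ℂ} (h1 : Vᴴ * V = 1) (h2 : V * Vᴴ = 1) {x : ℝ}
    (hx : x ∈ Set.Icc (0 : ℝ) 1) {y : ι → ℝ} (hy : ∀ i, 0 < y i) :
    segInv x (conjDiag V y) = conjDiag V (fun i => (1 + x * (y i - 1))⁻¹) := by
  rw [segInv, segment_conjDiag h2]
  refine Matrix.inv_eq_right_inv ?_
  rw [conjDiag_mul h1]
  simp only [mul_inv_cancel₀ (one_add_mul_sub_one_pos hx (hy _)).ne', conjDiag_one h2]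

lemma segment_posDef {Y : Matrix ι ι ℂ} (hY : Y.PosDef) {x : ℝ} (hx : x ∈ Set.Icc (0 : ℝ) 1) :
    (1 + x • (Y - 1)).PosDef := by
  obtain ⟨V, y, _, h2, hy, rfl, _⟩ := hY.exists_conjDiag
  rw [segment_conjDiag h2]
  exact conjDiag_posDef h2 fun i => one_add_mul_sub_one_pos hx (hy i)

lemma segInv_isHermitian {Y : Matrix ι ι ℂ} (hY : Y.PosDef) {x : ℝ}
    (hx : x ∈ Set.Icc (0 : ℝ) 1) : (segInv x Y).IsHermitian :=
  (segment_posDef hY hx).1.inv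

lemma segment_mul_segInv {Y : Matrix ι ι ℂ} (hY : Y.PosDef) {x : ℝ}
    (hx : x ∈ Set.Icc (0 : ℝ) 1) : (1 + x • (Y - 1)) * segInv x Y = 1 :=
  Matrix.mul_nonsing_inv _ ((Matrix.isUnit_iff_isUnit_det _).1 (segment_posDef hY hx).isUnit)

lemma segInv_mul_segment {Y : Matrix ι ι ℂ} (hY : Y.PosDef) {x : ℝ}
    (hx : x ∈ Set.Icc (0 : ℝ) 1) : segInv x Y * (1 + x • (Y - 1)) = 1 :=
  Matrix.nonsing_inv_mul _ ((Matrix.isUnit_iff_isUnit_det _).1 (segment_posDef hY hx).isUnit)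

lemma continuousOn_inv_segment {y : ℝ} (hy : 0 < y) :
    ContinuousOn (fun x : ℝ => (1 + x * (y - 1))⁻¹) (Set.uIcc 0 1) :=
  ContinuousOn.inv₀ (by fun_prop) fun _ hx =>
    (one_add_mul_sub_one_pos (Set.uIcc_of_le zero_le_one (α := ℝ) ▸ hx) hy).ne'

lemma integral_trR_log {Y : Matrix ι ι ℂ} (hY : Y.PosDef) (K : Matrix ι ι ℂ) :
    ∫ x in (0 : ℝ)..1, trR (K * ((Y - 1) * segInv x Y)) = trR (K * mlog Y) := by
  obtain ⟨V, y, h1, h2, hy, hY', hf⟩ := hY.exists_conjDiag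
  have hint : ∀ x ∈ Set.uIcc (0 : ℝ) 1, trR (K * ((Y - 1) * segInv x Y))
      = ∑ j, (y j - 1) * (1 + x * (y j - 1))⁻¹ * ((Vᴴ * K * V) j j).re := by
    intro x hx
    rw [Set.uIcc_of_le zero_le_one] at hx
    rw [hY', segInv_conjDiag h1 h2 hx hy, ← conjDiag_one h2, conjDiag_sub, conjDiag_mul h1,
      trR_mul_conjDiag]
  rw [intervalIntegral.integral_congr hint, intervalIntegral.integral_finsetSum]
  · rw [mlog, hf, trR_mul_conjDiag]
    simp only [intervalIntegral.integral_mul_const, integral_sub_one_div (hy _)]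
  · exact fun j _ => ((continuousOn_const.mul (continuousOn_inv_segment (hy j))).mul
      continuousOn_const).intervalIntegrable

lemma integral_trR_sq {Y : Matrix ι ι ℂ} (hY : Y.PosDef) (K : Matrix ι ι ℂ) :
    ∫ x in (0 : ℝ)..1, trR (K * (Y * (segInv x Y * segInv x Y))) = trR K := by
  obtain ⟨V, y, h1, h2, hy, hY', hf⟩ := hY.exists_conjDiag
  have hint : ∀ x ∈ Set.uIcc (0 : ℝ) 1, trR (K * (Y * (segInv x Y * segInv x Y)))
      = ∑ j, y j * ((1 + x * (y j - 1))⁻¹ * (1 + x * (y j - 1))⁻¹) *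
        ((Vᴴ * K * V) j j).re := by
    intro x hx
    rw [Set.uIcc_of_le zero_le_one] at hx
    rw [hY', segInv_conjDiag h1 h2 hx hy, conjDiag_mul h1, conjDiag_mul h1, trR_mul_conjDiag]
  rw [intervalIntegral.integral_congr hint, intervalIntegral.integral_finsetSum]
  · have := trR_mul_conjDiag K V (fun _ => 1)
    rw [conjDiag_one h2, mul_one] at this
    simp only [intervalIntegral.integral_mul_const, integral_div_sq (hy _), this]
  · exact fun j _ => ((continuousOn_const.mul ((continuousOn_inv_segment (hy j)).mul
      (continuousOn_inv_segment (hy j)))).mul continuousOn_const).intervalIntegrable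

end LogIntegral

/-! ### A trace inequality for commuting, similarly ordered matrices -/

section Rearrangement

lemma sum_mul_le_sum_mul_of_symm {ι : Type*} [Fintype ι] {w : ι → ι → ℝ} (hw : ∀ i j, 0 ≤ w i j)
    (hsymm : ∀ i j, w i j = w j i) {k l : ι → ℝ} (hkl : ∀ i j, 0 ≤ (k i - k j) * (l i - l j)) :
    ∑ i, ∑ j, k j * l i * w i j ≤ ∑ i, ∑ j, k i * l i * w i j := by
  have h1 : ∑ i, ∑ j, k j * l i * w i j = ∑ i, ∑ j, k i * l j * w i j := by
    rw [Finset.sum_comm]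
    exact Finset.sum_congr rfl fun i _ => Finset.sum_congr rfl fun j _ => by rw [hsymm]
  have h2 : ∑ i, ∑ j, k i * l i * w i j = ∑ i, ∑ j, k j * l j * w i j := by
    rw [Finset.sum_comm]
    exact Finset.sum_congr rfl fun i _ => Finset.sum_congr rfl fun j _ => by rw [hsymm]
  have h3 : 0 ≤ ∑ i, ∑ j, (k i - k j) * (l i - l j) * w i j :=
    Finset.sum_nonneg fun i _ => Finset.sum_nonneg fun j _ => mul_nonneg (hkl i j) (hw i j)
  have h4 : ∑ i, ∑ j, (k i - k j) * (l i - l j) * w i j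
      = ∑ i, ∑ j, k i * l i * w i j + ∑ i, ∑ j, k j * l j * w i j
        - ∑ i, ∑ j, k j * l i * w i j - ∑ i, ∑ j, k i * l j * w i j := by
    simp only [← Finset.sum_add_distrib, ← Finset.sum_sub_distrib]
    exact Finset.sum_congr rfl fun i _ => Finset.sum_congr rfl fun j _ => by ring
  linarith

variable {ι : Type*} [Fintype ι] [DecidableEq ι]

lemma trR_conjDiag_sandwich {R : Matrix ι ι ℂ} (hR : R.IsHermitian) (U : Matrix ι ι ℂ)
    (k l : ι → ℝ) :
    trR (R * conjDiag U k * R * conjDiag U l)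
      = ∑ i, ∑ j, k j * l i * Complex.normSq ((Uᴴ * R * U) i j) := by
  rw [trR_mul_conjDiag]
  refine Finset.sum_congr rfl fun i _ => ?_
  have hS : (Uᴴ * R * U).IsHermitian := isHermitian_conjTranspose_mul_mul U hR
  have : Uᴴ * (R * conjDiag U k * R) * U
      = Uᴴ * R * U * diagonal (fun i => (k i : ℂ)) * (Uᴴ * R * U) := by
    simp only [conjDiag, mul_assoc]
  rw [this, Matrix.mul_apply, Complex.re_sum, Finset.mul_sum]
  refine Finset.sum_congr rfl fun j _ => ?_
  rw [mul_diagonal, ← hS.apply j i, mul_right_comm, Complex.star_def, Complex.mul_conj]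
  rw [← Complex.ofReal_mul, Complex.ofReal_re]
  ring

lemma trR_sandwich_le {U : Matrix ι ι ℂ} (h1 : Uᴴ * U = 1) (h2 : U * Uᴴ = 1)
    {R : Matrix ι ι ℂ} (hR : R.IsHermitian) {k l : ι → ℝ}
    (hkl : ∀ i j, 0 ≤ (k i - k j) * (l i - l j)) :
    trR (conjDiag U k * (R * conjDiag U l * R))
      ≤ trR (conjDiag U k * conjDiag U l * (R * R)) := by
  have e1 : trR (conjDiag U k * (R * conjDiag U l * R))
      = trR (R * conjDiag U k * R * conjDiag U l) := by
    rw [trR_mul_comm (R * conjDiag U k * R), trR_mul_comm (conjDiag U k)]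
    rw [mul_assoc, mul_assoc, trR_mul_comm R]
    simp only [mul_assoc]
  have e2 : trR (conjDiag U k * conjDiag U l * (R * R))
      = trR (R * conjDiag U (fun _ => 1) * R * conjDiag U (fun i => k i * l i)) := by
    rw [conjDiag_mul h1, conjDiag_one h2, mul_one, trR_mul_comm]
  rw [e1, e2, trR_conjDiag_sandwich hR, trR_conjDiag_sandwich hR]
  simp only [one_mul]
  refine sum_mul_le_sum_mul_of_symm (fun _ _ => Complex.normSq_nonneg _) (fun i j => ?_) hkl
  have hS : (Uᴴ * R * U).IsHermitian := isHermitian_conjTranspose_mul_mul U hR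
  rw [← hS.apply i j, Complex.star_def, Complex.normSq_conj]

lemma trR_segInv_sandwich_le {U : Matrix ι ι ℂ} (h1 : Uᴴ * U = 1) (h2 : U * Uᴴ = 1)
    {k l : ι → ℝ} (hkl : ∀ i j, 0 ≤ (k i - k j) * (l i - l j)) {Y : Matrix ι ι ℂ}
    (hY : Y.PosDef) {x : ℝ} (hx : x ∈ Set.Ioc (0 : ℝ) 1) :
    trR (conjDiag U k * conjDiag U l * (Y * (segInv x Y * segInv x Y)))
      ≤ trR (conjDiag U k * (segInv x Y *
          ((1 / 2 : ℝ) • (conjDiag U l * Y + Y * conjDiag U l)) * segInv x Y)) := by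
  have hx' : x ∈ Set.Icc (0 : ℝ) 1 := ⟨hx.1.le, hx.2⟩
  have hNR := segment_mul_segInv hY hx'
  have hRN := segInv_mul_segment hY hx'
  have hcomm : conjDiag U k * conjDiag U l = conjDiag U l * conjDiag U k := by
    rw [conjDiag_mul h1, conjDiag_mul h1]
    simp only [mul_comm]
  have hmain := trR_sandwich_le h1 h2 (segInv_isHermitian hY hx') hkl
  set R := segInv x Y
  set K := conjDiag U k
  set L := conjDiag U l
  have hYR : x • (Y * R) = 1 - (1 - x) • R := by
    rw [← hNR]
    simp only [add_mul, sub_mul, smul_mul_assoc, one_mul, smul_sub, sub_smul, one_smul]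
    abel
  have hRY : x • (R * Y) = 1 - (1 - x) • R := by
    rw [← hRN]
    simp only [mul_add, mul_sub, mul_smul_comm, mul_one, smul_sub, sub_smul, one_smul]
    abel
  have e1 : x * trR (K * L * (Y * (R * R)))
      = trR (K * L * R) - (1 - x) * trR (K * L * (R * R)) := by
    rw [← trR_smul, ← mul_smul_comm, ← mul_assoc Y, ← smul_mul_assoc, hYR, sub_mul, one_mul,
      mul_sub, trR_sub, smul_mul_assoc, mul_smul_comm, trR_smul]
  have e2 : x * trR (K * (R * ((1 / 2 : ℝ) • (L * Y + Y * L)) * R))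
      = trR (K * L * R) - (1 - x) * trR (K * (R * L * R)) := by
    have expand : x • (R * ((1 / 2 : ℝ) • (L * Y + Y * L)) * R)
        = (1 / 2 : ℝ) • (R * L * (x • (Y * R)) + x • (R * Y) * (L * R)) := by
      simp only [mul_smul_comm, smul_mul_assoc, mul_add, add_mul, smul_add, mul_assoc,
        smul_comm x (1 / 2 : ℝ)]
    rw [← trR_smul, ← mul_smul_comm, expand, hYR, hRY, mul_smul_comm, trR_smul, mul_add, trR_add,
      mul_sub, mul_one, sub_mul, one_mul, mul_sub, mul_sub, trR_sub, trR_sub, mul_smul_comm,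
      mul_smul_comm, smul_mul_assoc, mul_smul_comm, trR_smul, trR_smul, ← mul_assoc K L R,
      ← mul_assoc K R L, trR_mul_comm (K * R) L, ← mul_assoc L K R, ← hcomm, mul_assoc R L R]
    ring
  have : x * trR (K * L * (Y * (R * R)))
      ≤ x * trR (K * (R * ((1 / 2 : ℝ) • (L * Y + Y * L)) * R)) := by
    rw [e1, e2]
    nlinarith [mul_nonneg (sub_nonneg.2 hx.2) (sub_nonneg.2 hmain)]
  exact le_of_mul_le_mul_left this hx.1

end Rearrangement

/-! ### Differentiation along a path of positive definite matrices -/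

section Path

open scoped Matrix.Norms.Operator

variable {ι : Type*} [Fintype ι] [DecidableEq ι]

lemma hasDerivAt_trR {M : ℝ → Matrix ι ι ℂ} {M' : Matrix ι ι ℂ} {s : ℝ}
    (h : HasDerivAt M M' s) (K : Matrix ι ι ℂ) :
    HasDerivAt (fun s => trR (K * M s)) (trR (K * M')) s := by
  let φ : Matrix ι ι ℂ →ₗ[ℝ] ℝ :=
    { toFun := fun M => trR (K * M)
      map_add' := fun A B => by rw [mul_add, trR_add]
      map_smul' := fun c A => by rw [mul_smul_comm, trR_smul]; rfl }
  exact (LinearMap.toContinuousLinearMap φ).hasFDerivAt.comp_hasDerivAt s h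

lemma hasDerivAt_conjDiag (V : Matrix ι ι ℂ) {g : ℝ → ι → ℝ} {g' : ι → ℝ} {s : ℝ}
    (h : ∀ i, HasDerivAt (fun s => g s i) (g' i) s) :
    HasDerivAt (fun s => conjDiag V (g s)) (conjDiag V g') s := by
  let φ : (ι → ℝ) →ₗ[ℝ] Matrix ι ι ℂ :=
    { toFun := conjDiag V
      map_add' := fun a b => (conjDiag_add V a b).symm
      map_smul' := fun c a => (conjDiag_smul V c a).symm }
  exact (LinearMap.toContinuousLinearMap φ).hasFDerivAt.comp_hasDerivAt s (hasDerivAt_pi.2 h)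

lemma hasDerivAt_segInv {Y : ℝ → Matrix ι ι ℂ} {Y' : Matrix ι ι ℂ} {s : ℝ}
    (h : HasDerivAt Y Y' s) (hY : (Y s).PosDef) {x : ℝ} (hx : x ∈ Set.Icc (0 : ℝ) 1) :
    HasDerivAt (fun s => (Y s - 1) * segInv x (Y s))
      (segInv x (Y s) * Y' * segInv x (Y s)) s := by
  have hN : HasDerivAt (fun s => 1 + x • (Y s - 1)) (x • Y') s :=
    ((h.sub_const 1).const_smul x).const_add 1
  obtain ⟨v, hv⟩ := (segment_posDef hY hx).isUnit
  have hinv : HasDerivAt (fun s => segInv x (Y s))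
      (-(segInv x (Y s) * (x • Y') * segInv x (Y s))) s := by
    have h0 := hasFDerivAt_ringInverse (𝕜 := ℝ) v
    rw [hv] at h0
    have h1 := h0.comp_hasDerivAt s hN
    have hvi : (↑v⁻¹ : Matrix ι ι ℂ) = segInv x (Y s) := by
      rw [segInv, ← hv, Matrix.coe_units_inv]
    have hfun : (fun s => segInv x (Y s)) = Ring.inverse ∘ fun s => 1 + x • (Y s - 1) := by
      funext t
      simp [segInv, Matrix.nonsing_inv_eq_ringInverse]
    rw [hfun]
    refine h1.congr_deriv ?_
    simp [hvi]
  refine ((h.sub_const 1).mul hinv).congr_deriv ?_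
  have hR : segInv x (Y s) = 1 - x • ((Y s - 1) * segInv x (Y s)) := by
    have hNR := segment_mul_segInv hY hx
    rw [add_mul, smul_mul_assoc, one_mul] at hNR
    exact eq_sub_of_add_eq hNR
  conv_rhs => rw [mul_assoc, hR, sub_mul, ← hR]
  simp only [one_mul, mul_smul_comm, smul_mul_assoc, mul_neg, mul_assoc, sub_eq_add_neg]

end Path

section PathContinuity

lemma continuous_smul_mul_add_mul {ι : Type*} [Fintype ι] {Y : ℝ → Matrix ι ι ℂ}
    (hYc : Continuous Y) (c : ℝ) (L : Matrix ι ι ℂ) :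
    Continuous fun s => c • (L * Y s + Y s * L) :=
  ((continuous_const.mul hYc).add (hYc.mul continuous_const)).const_smul c

variable {ι : Type*} [Fintype ι] [DecidableEq ι]

lemma continuousOn_segInv {X : Type*} [TopologicalSpace X] {x : X → ℝ} {Y : X → Matrix ι ι ℂ}
    {S : Set X} (hxc : ContinuousOn x S) (hYc : ContinuousOn Y S)
    (hx : ∀ q ∈ S, x q ∈ Set.Icc (0 : ℝ) 1) (hY : ∀ q, (Y q).PosDef) :
    ContinuousOn (fun q => segInv (x q) (Y q)) S := by
  have hN : ContinuousOn (fun q => 1 + x q • (Y q - 1)) S :=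
    continuousOn_const.add (hxc.smul (hYc.sub continuousOn_const))
  have hdet : ContinuousOn (fun q => (1 + x q • (Y q - 1)).det) S :=
    continuousOn_iff_continuous_domRestrict.2
      (continuousOn_iff_continuous_domRestrict.1 hN).matrix_det
  have hadj : ContinuousOn (fun q => (1 + x q • (Y q - 1)).adjugate) S :=
    continuousOn_iff_continuous_domRestrict.2
      (continuousOn_iff_continuous_domRestrict.1 hN).matrix_adjugate
  simp only [segInv, Matrix.inv_def, Ring.inverse_eq_inv']
  exact (hdet.inv₀ fun q hq =>
    ((Matrix.isUnit_iff_isUnit_det _).1 (segment_posDef (hY q) (hx q hq)).isUnit).ne_zero).smul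
    hadj

lemma continuousOn_trR_log {Y : Matrix ι ι ℂ} (hY : Y.PosDef) (K : Matrix ι ι ℂ) :
    ContinuousOn (fun x : ℝ => trR (K * ((Y - 1) * segInv x Y))) (Set.Icc 0 1) := by
  have hR : ContinuousOn (fun x : ℝ => segInv x Y) (Set.Icc 0 1) :=
    continuousOn_segInv continuousOn_id continuousOn_const (fun _ hx => hx) fun _ => hY
  exact continuous_trR.comp_continuousOn
    (continuousOn_const.mul (continuousOn_const.mul hR))

lemma continuousOn_trR_sq {Y : ℝ → Matrix ι ι ℂ} (hYc : Continuous Y)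
    (hY : ∀ s, (Y s).PosDef) (K : Matrix ι ι ℂ) :
    ContinuousOn
      (fun q : ℝ × ℝ => trR (K * (Y q.2 * (segInv q.1 (Y q.2) * segInv q.1 (Y q.2)))))
      (Set.Icc 0 1 ×ˢ Set.univ) := by
  have hY2 : ContinuousOn (fun q : ℝ × ℝ => Y q.2) (Set.Icc 0 1 ×ˢ Set.univ) :=
    (hYc.comp continuous_snd).continuousOn
  have hR : ContinuousOn (fun q : ℝ × ℝ => segInv q.1 (Y q.2)) (Set.Icc 0 1 ×ˢ Set.univ) :=
    continuousOn_segInv continuousOn_fst hY2 (fun q hq => hq.1) fun q => hY q.2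
  exact continuous_trR.comp_continuousOn (continuousOn_const.mul (hY2.mul (hR.mul hR)))

lemma continuous_trR_sandwich {Y Z : ℝ → Matrix ι ι ℂ} (hYc : Continuous Y)
    (hY : ∀ s, (Y s).PosDef) (hZ : Continuous Z) (K : Matrix ι ι ℂ) {x : ℝ}
    (hx : x ∈ Set.Icc (0 : ℝ) 1) :
    Continuous fun s => trR (K * (segInv x (Y s) * Z s * segInv x (Y s))) := by
  have hR : Continuous fun s => segInv x (Y s) :=
    continuousOn_univ.1 (continuousOn_segInv continuousOn_const hYc.continuousOn
      (fun _ _ => hx) hY)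
  exact continuous_trR.comp (continuous_const.mul ((hR.mul hZ).mul hR))

end PathContinuity

/-! ### Logarithmic trace inequality -/

section ParametricGrowth

open MeasureTheory Set

lemma mul_le_integral_sub_integral {G D H : ℝ → ℝ → ℝ} {c p : ℝ} (hp : 0 ≤ p)
    (hH : ContinuousOn (Function.uncurry H) (Icc 0 1 ×ˢ univ))
    (hG : ∀ s, ContinuousOn (fun x => G x s) (Icc 0 1))
    (hD : ∀ x ∈ Icc (0 : ℝ) 1, Continuous (D x))
    (hGD : ∀ x ∈ Icc (0 : ℝ) 1, ∀ s, HasDerivAt (G x) (D x s) s)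
    (hHD : ∀ x ∈ Ioc (0 : ℝ) 1, ∀ s, H x s ≤ D x s)
    (hc : ∀ s, ∫ x in (0 : ℝ)..1, H x s = c) :
    p * c ≤ (∫ x in (0 : ℝ)..1, G x p) - ∫ x in (0 : ℝ)..1, G x 0 := by
  have hHint : Integrable (Function.uncurry H)
      ((volume.restrict (Ioc (0 : ℝ) 1)).prod (volume.restrict (Ioc 0 p))) := by
    rw [Measure.prod_restrict]
    refine IntegrableOn.mono_set (t := Icc (0 : ℝ) 1 ×ˢ Icc 0 p) ?_
      (prod_mono Ioc_subset_Icc_self Ioc_subset_Icc_self)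
    exact (hH.mono (prod_mono subset_rfl (subset_univ _))).integrableOn_compact
      (isCompact_Icc.prod isCompact_Icc)
  have hGi : ∀ s, IntervalIntegrable (fun x => G x s) volume 0 1 := fun s =>
    ContinuousOn.intervalIntegrable (by rw [uIcc_of_le zero_le_one]; exact hG s)
  have hstep : ∀ x ∈ Ioc (0 : ℝ) 1, ∫ s in Ioc 0 p, H x s ≤ G x p - G x 0 := by
    intro x hx
    have hx' : x ∈ Icc (0 : ℝ) 1 := ⟨hx.1.le, hx.2⟩
    have hHx : Continuous (H x) :=
      hH.comp_continuous (Continuous.prodMk_right x) fun s => ⟨hx', mem_univ s⟩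
    rw [← intervalIntegral.integral_eq_sub_of_hasDerivAt (f := G x) (f' := D x)
      (fun s _ => hGD x hx' s) ((hD x hx').intervalIntegrable _ _),
      ← intervalIntegral.integral_of_le hp]
    exact intervalIntegral.integral_mono_on hp (hHx.intervalIntegrable _ _)
      ((hD x hx').intervalIntegrable _ _) fun s _ => hHD x hx s
  calc p * c
      = ∫ s in Ioc 0 p, ∫ x in Ioc (0 : ℝ) 1, H x s := by
        simp only [← intervalIntegral.integral_of_le (zero_le_one (α := ℝ)),
          ← intervalIntegral.integral_of_le hp, hc]
        simp
    _ = ∫ x in Ioc (0 : ℝ) 1, ∫ s in Ioc 0 p, H x s := (integral_integral_swap hHint).symm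
    _ ≤ ∫ x in Ioc (0 : ℝ) 1, (G x p - G x 0) :=
        setIntegral_mono_on hHint.integral_prod_left
          (((hGi p).sub (hGi 0)).1) measurableSet_Ioc hstep
    _ = (∫ x in (0 : ℝ)..1, G x p) - ∫ x in (0 : ℝ)..1, G x 0 := by
        rw [← intervalIntegral.integral_of_le (zero_le_one (α := ℝ)),
          intervalIntegral.integral_sub (hGi p) (hGi 0)]

end ParametricGrowth

section LogTrace

open scoped Matrix.Norms.Operator

variable {ι : Type*} [Fintype ι] [DecidableEq ι]

/-- Growth of `s ↦ Tr[K log Y(s)]` along a path satisfying `Y' = (L Y + Y L) / 2`, when `K` and `L`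
commute and are similarly ordered. -/
lemma mul_trR_le_trR_mlog_sub {U : Matrix ι ι ℂ} (h1 : Uᴴ * U = 1) (h2 : U * Uᴴ = 1)
    {k l : ι → ℝ} (hkl : ∀ i j, 0 ≤ (k i - k j) * (l i - l j)) {Y : ℝ → Matrix ι ι ℂ}
    (hY : ∀ s, (Y s).PosDef)
    (hY' : ∀ s, HasDerivAt Y ((1 / 2 : ℝ) • (conjDiag U l * Y s + Y s * conjDiag U l)) s)
    {p : ℝ} (hp : 0 ≤ p) :
    p * trR (conjDiag U k * conjDiag U l)
      ≤ trR (conjDiag U k * mlog (Y p)) - trR (conjDiag U k * mlog (Y 0)) := by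
  have hYc : Continuous Y := continuous_iff_continuousAt.2 fun s => (hY' s).continuousAt
  rw [← integral_trR_log (hY p), ← integral_trR_log (hY 0)]
  exact mul_le_integral_sub_integral
    (G := fun x s => trR (conjDiag U k * ((Y s - 1) * segInv x (Y s))))
    (H := fun x s => trR (conjDiag U k * conjDiag U l *
      (Y s * (segInv x (Y s) * segInv x (Y s)))))
    (D := fun x s => trR (conjDiag U k * (segInv x (Y s) *
      ((1 / 2 : ℝ) • (conjDiag U l * Y s + Y s * conjDiag U l)) * segInv x (Y s)))) hp
    (continuousOn_trR_sq hYc hY _)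
    (fun s => continuousOn_trR_log (hY s) _)
    (fun x hx => continuous_trR_sandwich hYc hY (continuous_smul_mul_add_mul hYc _ _) _ hx)
    (fun x hx s => hasDerivAt_trR (hasDerivAt_segInv (hY' s) (hY s) hx) _)
    (fun x hx s => trR_segInv_sandwich_le h1 h2 hkl (hY s) hx)
    (fun s => integral_trR_sq (hY s) _)

/-- The logarithmic trace inequality
`Tr[A (p log A + log B)] ≤ Tr[A log (A^{p/2} B A^{p/2})]`. -/
theorem trR_mul_mlog_add_le {A B : Matrix ι ι ℂ} (hA : A.PosDef) (hB : B.PosDef) {p : ℝ}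
    (hp : 0 ≤ p) :
    p * trR (A * mlog A) + trR (A * mlog B)
      ≤ trR (A * mlog (mpow A (p / 2) * B * mpow A (p / 2))) := by
  have hYpos : ∀ s : ℝ, (mpow A (s / 2) * B * mpow A (s / 2)).PosDef := fun s => by
    have hE := mpow_posDef hA (s / 2)
    have := hB.mul_mul_conjTranspose_same (B := mpow A (s / 2))
      (Matrix.vecMul_injective_of_isUnit hE.isUnit)
    rwa [hE.1.eq] at this
  obtain ⟨U, a, h1, h2, ha, hA', hf⟩ := hA.exists_conjDiag
  have hlog : mlog A = conjDiag U (fun i => Real.log (a i)) := hf _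
  have hE : ∀ s : ℝ, HasDerivAt (fun s => mpow A (s / 2))
      ((1 / 2 : ℝ) • (mlog A * mpow A (s / 2))) s := by
    intro s
    have hpow : ∀ s : ℝ, mpow A (s / 2) = conjDiag U (fun i => a i ^ (s / 2)) := fun s => hf _
    simp only [hlog, hpow, conjDiag_mul h1, conjDiag_smul]
    refine hasDerivAt_conjDiag U fun i => ?_
    refine (((hasDerivAt_id' s).div_const 2).const_rpow (ha i)).congr_deriv ?_
    ring
  have hcomm : ∀ s : ℝ, mlog A * mpow A s = mpow A s * mlog A := fun s => by
    rw [mlog, mpow, hf, hf, conjDiag_mul h1, conjDiag_mul h1]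
    simp only [mul_comm]
  have hmono : ∀ i j, 0 ≤ (a i - a j) * (Real.log (a i) - Real.log (a j)) := fun i j => by
    rcases le_total (a i) (a j) with h | h
    · exact mul_nonneg_of_nonpos_of_nonpos (sub_nonpos.2 h)
        (sub_nonpos.2 (Real.log_le_log (ha i) h))
    · exact mul_nonneg (sub_nonneg.2 h) (sub_nonneg.2 (Real.log_le_log (ha j) h))
  have key := mul_trR_le_trR_mlog_sub h1 h2 hmono hYpos (fun s => ?_) hp
  · rw [← hA', ← hlog, zero_div, mpow_zero hA, one_mul, mul_one] at key
    linarith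
  · refine (((hE s).mul_const B).mul (hE s)).congr_deriv ?_
    rw [← hlog]
    simp only [smul_mul_assoc, mul_smul_comm, smul_add, mul_assoc]
    rw [hcomm]

end LogTrace

/-- fixed-point lower bound for the Augustin mean, `α > 1`. -/
theorem augustin_mean_fixed_point_gt_one {d n : ℕ} (hd : 0 < d) (hn : 0 < n)
    (W : Fin n → Matrix (Fin d) (Fin d) ℂ)
    (hW : ∀ i, (W i).PosDef ∧ (W i).trace = 1)
    (P : Fin n → ℝ) (hP : ∀ i, 0 ≤ P i) (hP1 : ∑ i, P i = 1)
    (α : ℝ) (hα : 1 < α)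
    (u : Matrix (Fin d) (Fin d) ℂ) (hu : u.PosDef) (hu1 : u.trace = 1)
    (hfix : u = ∑ i,
      (P i / trR (mpow u ((1 - α) / 2) * mpow (W i) α * mpow u ((1 - α) / 2))) •
        (mpow u ((1 - α) / 2) * mpow (W i) α * mpow u ((1 - α) / 2))) :
    ∀ τ : Matrix (Fin d) (Fin d) ℂ, τ.PosDef → τ.trace = 1 →
      Dumegaki u τ ≤ ∑ i, P i * Dpetz α (W i) τ - ∑ i, P i * Dpetz α (W i) u := by
  intro τ hτ hτ1
  have : Nonempty (Fin d) := ⟨⟨0, hd⟩⟩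
  have hWα : ∀ i, (mpow (W i) α).PosDef := fun i => mpow_posDef (hW i).1 α
  have hE := mpow_posDef hu ((1 - α) / 2)
  have hF := mpow_posDef hu ((α - 1) / 2)
  have hEF : mpow u ((1 - α) / 2) * mpow u ((α - 1) / 2) = 1 := by
    rw [mpow_mul_mpow hu, ← add_div, sub_add_sub_cancel, sub_self, zero_div, mpow_zero hu]
  have hFE : mpow u ((α - 1) / 2) * mpow u ((1 - α) / 2) = 1 := by
    rw [mpow_mul_mpow hu, ← add_div, sub_add_sub_cancel, sub_self, zero_div, mpow_zero hu]
  have hEE : mpow u ((1 - α) / 2) * mpow u ((1 - α) / 2) = mpow u (1 - α) := by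
    rw [mpow_mul_mpow hu, add_halves]
  have hB := mpow_posDef hτ (1 - α)
  have hX : (mpow u ((α - 1) / 2) * mpow τ (1 - α) * mpow u ((α - 1) / 2)).PosDef := by
    have := hB.mul_mul_conjTranspose_same (B := mpow u ((α - 1) / 2))
      (Matrix.vecMul_injective_of_isUnit hF.isUnit)
    rwa [hF.1.eq] at this
  have hlogtrace := trR_mul_mlog_add_le hu hB (sub_nonneg.2 hα.le)
  rw [mlog_mpow hτ, mul_smul_comm, trR_smul] at hlogtrace
  set E := mpow u ((1 - α) / 2)
  set F := mpow u ((α - 1) / 2)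
  set X := F * mpow τ (1 - α) * F
  have hT : ∀ i, trR (E * mpow (W i) α * E) = trR (mpow (W i) α * mpow u (1 - α)) := fun i => by
    rw [mul_assoc, trR_mul_comm, mul_assoc, hEE]
  have hTpos : ∀ i, 0 < trR (E * mpow (W i) α * E) := fun i => by
    rw [hT]
    exact trR_mul_pos (hWα i) (mpow_posDef hu _)
  have hterm : ∀ i, (1 / trR (E * mpow (W i) α * E)) * trR (E * mpow (W i) α * E * mlog X)
      ≤ Real.log (trR (mpow (W i) α * mpow τ (1 - α)))
        - Real.log (trR (mpow (W i) α * mpow u (1 - α))) := by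
    intro i
    have hpsd : ((1 / trR (E * mpow (W i) α * E)) • (E * mpow (W i) α * E)).PosSemidef := by
      have := (hWα i).posSemidef.mul_mul_conjTranspose_same E
      rw [hE.1.eq] at this
      exact this.smul (one_div_nonneg.2 (hTpos i).le)
    have hJ := trR_mul_mlog_le_log hpsd
      (by rw [trR_smul, one_div_mul_cancel (hTpos i).ne']) hX
    have hEX : trR (E * mpow (W i) α * E * X) = trR (mpow (W i) α * mpow τ (1 - α)) := by
      have : E * mpow (W i) α * E * X = E * (mpow (W i) α * (E * F) * mpow τ (1 - α) * F) := by
        simp only [X, mul_assoc]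
      rw [this, trR_mul_comm, hEF, mul_one, mul_assoc, hFE, mul_one]
    rw [smul_mul_assoc, trR_smul, smul_mul_assoc, trR_smul, hEX, one_div_mul_eq_div _
      (trR (mpow (W i) α * mpow τ (1 - α))), Real.log_div (trR_mul_pos (hWα i) hB).ne'
      (hTpos i).ne', hT i] at hJ
    rw [hT i]
    exact hJ
  have hsum : trR (u * mlog X) = ∑ i, P i *
      ((1 / trR (E * mpow (W i) α * E)) * trR (E * mpow (W i) α * E * mlog X)) := by
    have := congrArg (fun A => trR (A * mlog X)) hfix
    simp only [Finset.sum_mul, trR_sum, smul_mul_assoc, trR_smul] at this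
    rw [this]
    exact Finset.sum_congr rfl fun i _ => by ring
  have hle : trR (u * mlog X) ≤ ∑ i, P i *
      (Real.log (trR (mpow (W i) α * mpow τ (1 - α)))
        - Real.log (trR (mpow (W i) α * mpow u (1 - α)))) := by
    rw [hsum]
    exact Finset.sum_le_sum fun i _ => mul_le_mul_of_nonneg_left (hterm i) (hP i)
  have hD : ∑ i, P i * Dpetz α (W i) τ - ∑ i, P i * Dpetz α (W i) u = (1 / (α - 1)) * ∑ i, P i *
      (Real.log (trR (mpow (W i) α * mpow τ (1 - α)))
        - Real.log (trR (mpow (W i) α * mpow u (1 - α)))) := by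
    rw [← Finset.sum_sub_distrib, Finset.mul_sum]
    exact Finset.sum_congr rfl fun i _ => by simp only [Dpetz]; ring
  rw [hD, one_div_mul_eq_div, le_div_iff₀ (sub_pos.2 hα), Dumegaki, mul_sub u, trR_sub]
  linarith
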